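/- arXiv:2402.17732 — 6 statements merged into one kernel-verified Lean document; each statement's English description precedes it below -/
import Mathlib

section
/- Let γ ∈ (0,1), let M ≥ 1 be an integer, and let t₁, t₂, …, t_M be positive real numbers with t_M = T. Then max{ t₁ , max_{2 ≤ i ≤ M} t_i / t_{i−1}^γ } ≥ T^{(1−γ)/(1−γ^M)}. -/
/-- A sequence whose increments satisfy `x (k + 1) < c + γ * x k` stays strictly below
the solution `c * (1 - γ ^ n) / (1 - γ)` of the corresponding linear recursion. -/
theorem mul_one_sub_lt_of_linear_recursion {γ c : ℝ} (hγ0 : 0 < γ) (hγ1 : γ < 1) {M : ℕ}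
    {x : ℕ → ℝ} (h_one : x 1 < c) (h_succ : ∀ k, 1 ≤ k → k < M → x (k + 1) < c + γ * x k)
    {n : ℕ} (hn : 1 ≤ n) (hnM : n ≤ M) : x n * (1 - γ) < c * (1 - γ ^ n) := by
  have hγ : 0 < 1 - γ := sub_pos.2 hγ1
  induction n, hn using Nat.le_induction with
  | base => simpa using mul_lt_mul_of_pos_right h_one hγ
  | succ k hk ih =>
    calc x (k + 1) * (1 - γ) < (c + γ * x k) * (1 - γ) :=
          mul_lt_mul_of_pos_right (h_succ k hk hnM) hγ
      _ = c * (1 - γ) + γ * (x k * (1 - γ)) := by ring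
      _ < c * (1 - γ) + γ * (c * (1 - γ ^ k)) :=
          add_lt_add_right (mul_lt_mul_of_pos_left (ih (by omega)) hγ0) _
      _ = c * (1 - γ ^ (k + 1)) := by ring

/-- Let `γ ∈ (0,1)`, `M ≥ 1` an integer, and `t 1, …, t M` positive reals
with `t M = T`. Then the maximum of `t 1` and of `t i / (t (i-1))^γ` for `2 ≤ i ≤ M`
is at least `T ^ ((1 - γ)/(1 - γ^M))`. We phrase the maximum as: some term attains the bound. -/
theorem stmt_0 (γ T : ℝ) (hγ0 : 0 < γ) (hγ1 : γ < 1)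
    (M : ℕ) (hM : 1 ≤ M) (t : ℕ → ℝ)
    (ht_pos : ∀ i, 1 ≤ i → i ≤ M → 0 < t i)
    (htM : t M = T) :
    ∃ i, 1 ≤ i ∧ i ≤ M ∧
      T ^ ((1 - γ) / (1 - γ ^ M)) ≤
        (if i = 1 then t 1 else t i / (t (i - 1)) ^ γ) := by
  have hT : 0 < T := htM ▸ ht_pos M hM le_rfl
  by_contra! h
  have h_one : Real.log (t 1) < (1 - γ) / (1 - γ ^ M) * Real.log T := by
    rw [← Real.log_rpow hT]
    exact Real.log_lt_log (ht_pos 1 le_rfl hM) (by simpa using h 1 le_rfl hM)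
  have h_succ : ∀ k, 1 ≤ k → k < M → Real.log (t (k + 1)) <
      (1 - γ) / (1 - γ ^ M) * Real.log T + γ * Real.log (t k) := by
    intro k hk hkM
    have hk_pos := ht_pos k hk hkM.le
    have hk_succ := ht_pos (k + 1) (by omega) hkM
    have hlt := h (k + 1) (by omega) hkM
    rw [if_neg (by omega), Nat.add_sub_cancel, div_lt_iff₀ (by positivity)] at hlt
    have hlog := Real.log_lt_log hk_succ hlt
    rwa [Real.log_mul (by positivity) (by positivity), Real.log_rpow hT,
      Real.log_rpow hk_pos] at hlog
  have hlt := mul_one_sub_lt_of_linear_recursion (x := fun k => Real.log (t k)) hγ0 hγ1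
    h_one h_succ hM le_rfl
  have hγM : 1 - γ ^ M ≠ 0 := (sub_pos.2 (pow_lt_one₀ hγ0.le hγ1 (by omega))).ne'
  rw [htM, mul_right_comm, div_mul_cancel₀ _ hγM, mul_comm] at hlt
  exact lt_irrefl _ hlt
end

section
/- Fix an integer d ≥ 1, β ∈ (0,1], L > 0, and an integer z ≥ 1. Set D_φ = min(2^{−β}L, 1/4). For v ∈ {1,…,z}^d, let C_v = ∏_{j=1}^d [(v_j−1)/z, v_j/z) be the half-open cube of side length 1/z with center q_v whose j-th coordinate is (v_j − 1/2)/z. For any assignment ω : {1,…,z}^d → {−1, 0, 1}, define f_ω : [0,1]^d → ℝ by f_ω(x) = 1/2 + Σ_v ω(v) · D_φ z^{−β} φ(2z(x − q_v)) · 1{x ∈ C_v}. Then for all x, x′ ∈ [0,1]^d, |f_ω(x) − f_ω(x′)| ≤ 2L‖x − x′‖₂^β. -/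
/-- Subadditivity of `t ↦ t ^ β` for `0 ≤ β ≤ 1`, as a Hölder bound. -/
theorem abs_rpow_sub_rpow_le {a b β : ℝ} (ha : 0 ≤ a) (hb : 0 ≤ b) (hβ0 : 0 ≤ β) (hβ1 : β ≤ 1) :
    |a ^ β - b ^ β| ≤ |a - b| ^ β := by
  wlog h : b ≤ a generalizing a b
  · rw [abs_sub_comm, abs_sub_comm a b]
    exact this hb ha (le_of_not_ge h)
  have hsub : (a - b + b) ^ β ≤ (a - b) ^ β + b ^ β :=
    Real.rpow_add_le_add_rpow (sub_nonneg.2 h) hb hβ0 hβ1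
  rw [sub_add_cancel] at hsub
  rw [abs_of_nonneg (sub_nonneg.2 (Real.rpow_le_rpow hb h hβ0)), abs_of_nonneg (sub_nonneg.2 h)]
  linarith

theorem ite_one_sub_norm_rpow_eq {E : Type*} [SeminormedAddCommGroup E] {β : ℝ} (hβ : 0 < β)
    (y : E) : (if ‖y‖ ≤ 1 then (1 - ‖y‖) ^ β else 0) = max (1 - ‖y‖) 0 ^ β := by
  split_ifs with h
  · rw [max_eq_left (by linarith)]
  · rw [max_eq_right (by linarith), Real.zero_rpow hβ.ne']

/-- The bump `y ↦ max (1 - ‖y‖) 0 ^ β` is `β`-Hölder with constant one. -/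
theorem abs_bump_sub_bump_le {E : Type*} [SeminormedAddCommGroup E] {β : ℝ} (hβ0 : 0 ≤ β)
    (hβ1 : β ≤ 1) (y y' : E) :
    |max (1 - ‖y‖) 0 ^ β - max (1 - ‖y'‖) 0 ^ β| ≤ ‖y - y'‖ ^ β := by
  refine (abs_rpow_sub_rpow_le (le_max_right _ _) (le_max_right _ _) hβ0 hβ1).trans ?_
  refine Real.rpow_le_rpow (abs_nonneg _) ?_ hβ0
  refine (abs_max_sub_max_le_abs _ _ _).trans ?_
  rw [sub_sub_sub_cancel_left, norm_sub_rev]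
  exact abs_norm_sub_norm_le _ _

theorem pi_norm_le_sqrt_sum_sq {ι : Type*} [Fintype ι] (y : ι → ℝ) :
    ‖y‖ ≤ Real.sqrt (∑ j, y j ^ 2) := by
  refine (pi_norm_le_iff_of_nonneg (Real.sqrt_nonneg _)).2 fun j => ?_
  exact Real.abs_le_sqrt (Finset.single_le_sum (f := fun j => y j ^ 2)
    (fun i _ => sq_nonneg _) (Finset.mem_univ j))

/-- If every difference is at most `B`, and both `g` and `g'` vanish outside subsingletons, then
the sums of `g` and `g'` differ by at most `2 * B`. -/
theorem abs_sum_sub_sum_le_two_mul {ι : Type*} (s : Finset ι) (p p' : ι → Prop)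
    (g g' : ι → ℝ) {B : ℝ} (hB : 0 ≤ B) (hp : ∀ i j, p i → p j → i = j)
    (hp' : ∀ i j, p' i → p' j → i = j) (hg : ∀ i, ¬ p i → g i = 0) (hg' : ∀ i, ¬ p' i → g' i = 0)
    (h : ∀ i, |g i - g' i| ≤ B) : |∑ i ∈ s, g i - ∑ i ∈ s, g' i| ≤ 2 * B := by
  classical
  have key : ∀ r : ι → Prop, (∀ i j, r i → r j → i = j) →
      ∑ i ∈ s, (if r i then B else 0) ≤ B := by
    intro r hr
    rw [← Finset.sum_filter, Finset.sum_const, nsmul_eq_mul]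
    have hcard : (s.filter r).card ≤ 1 := Finset.card_le_one.2 fun i hi j hj =>
      hr i j (Finset.mem_filter.1 hi).2 (Finset.mem_filter.1 hj).2
    exact mul_le_of_le_one_left hB (by exact_mod_cast hcard)
  calc |∑ i ∈ s, g i - ∑ i ∈ s, g' i| ≤ ∑ i ∈ s, |g i - g' i| := by
        rw [← Finset.sum_sub_distrib]
        exact Finset.abs_sum_le_sum_abs _ _
    _ ≤ ∑ i ∈ s, ((if p i then B else 0) + (if p' i then B else 0)) := by
        refine Finset.sum_le_sum fun i _ => ?_
        have hi := h i
        by_cases h1 : p i <;> by_cases h2 : p' i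
        · simp only [h1, h2, if_true]; linarith
        · simpa [h1, h2] using hi
        · simpa [h1, h2] using hi
        · simp [h1, h2, hg i h1, hg' i h2]
    _ ≤ 2 * B := by
        rw [Finset.sum_add_distrib]
        linarith [key p hp, key p' hp']

open scoped Classical in
/-- The hard reward instances `f_ω` built from the bump `φ` on a regular
partition of `[0,1]^d` into `z^d` cubes are `(β, 2L)`-Hölder with respect to the Euclidean
norm on `[0,1]^d`. Here `ℝ^d` is modeled as `Fin d → ℝ` (so `‖·‖` is the sup norm used to
define `φ`), and the Euclidean norm is written explicitly as `√(∑ j, (x j - x' j)²)`. -/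
theorem stmt_3 (d z : ℕ) (hd : 1 ≤ d) (hz : 1 ≤ z)
    (β L : ℝ) (hβ0 : 0 < β) (hβ1 : β ≤ 1) (hL : 0 < L)
    (φ : (Fin d → ℝ) → ℝ)
    (hφ : ∀ x : Fin d → ℝ, φ x = if ‖x‖ ≤ 1 then (1 - ‖x‖) ^ β else 0)
    (Dφ : ℝ) (hDφ : Dφ = min ((2 : ℝ) ^ (-β) * L) (1 / 4))
    (q : (Fin d → ℕ) → Fin d → ℝ)
    (hq : ∀ v j, q v j = ((v j : ℝ) - 1 / 2) / z)
    (C : (Fin d → ℕ) → Set (Fin d → ℝ))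
    (hC : ∀ v, C v = {x | ∀ j, ((v j : ℝ) - 1) / z ≤ x j ∧ x j < (v j : ℝ) / z})
    (ω : (Fin d → ℕ) → ℝ) (hω : ∀ v, ω v = -1 ∨ ω v = 0 ∨ ω v = 1)
    (f : (Fin d → ℝ) → ℝ)
    (hf : ∀ x : Fin d → ℝ,
      f x = 1 / 2 + ∑ v ∈ Fintype.piFinset (fun _ : Fin d => Finset.Icc 1 z),
        ω v * (Dφ * (z : ℝ) ^ (-β) * φ (fun j => 2 * z * (x j - q v j)) *
          (if x ∈ C v then 1 else 0)))
    (x x' : Fin d → ℝ) (hx : ∀ j, x j ∈ Set.Icc (0 : ℝ) 1)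
    (hx' : ∀ j, x' j ∈ Set.Icc (0 : ℝ) 1) :
    |f x - f x'| ≤ 2 * L * Real.sqrt (∑ j, (x j - x' j) ^ 2) ^ β := by

  have hz0 : (0 : ℝ) < z := by exact_mod_cast hz
  have hD0 : 0 < Dφ := by rw [hDφ]; positivity
  have hD : Dφ * 2 ^ β ≤ L := by
    calc Dφ * 2 ^ β ≤ (2 : ℝ) ^ (-β) * L * 2 ^ β := by
          gcongr
          exact hDφ ▸ min_le_left _ _
      _ = L := by
          rw [Real.rpow_neg two_pos.le]
          field_simp
  have hφ' : ∀ y, φ y = max (1 - ‖y‖) 0 ^ β := fun y =>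
    (hφ y).trans (ite_one_sub_norm_rpow_eq hβ0 y)
  have hmem : ∀ (y : Fin d → ℝ) v, y ∈ C v ↔ ∀ j, (v j : ℝ) - 1 ≤ y j * z ∧ y j * z < v j := by
    intro y v
    rw [hC]
    simp only [Set.mem_ofPred_eq, div_le_iff₀ hz0, lt_div_iff₀ hz0]
  have hout : ∀ (y : Fin d → ℝ) v, y ∉ C v → φ (fun j => 2 * z * (y j - q v j)) = 0 := by
    intro y v hy
    have hnorm : 1 ≤ ‖fun j => 2 * (z : ℝ) * (y j - q v j)‖ := by
      by_contra! hlt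
      refine hy ((hmem y v).2 fun j => ?_)
      have hj := (norm_le_pi_norm (fun j => 2 * (z : ℝ) * (y j - q v j)) j).trans_lt hlt
      have hq' : 2 * (z : ℝ) * (y j - q v j) = 2 * (y j * z) - (2 * v j - 1) := by
        rw [hq]
        field_simp
      rw [Real.norm_eq_abs, hq', abs_lt] at hj
      constructor <;> linarith [hj.1, hj.2]
    rw [hφ', max_eq_right (by linarith), Real.zero_rpow hβ0.ne']
  have hterm : ∀ (y : Fin d → ℝ) v, φ (fun j => 2 * z * (y j - q v j)) * (if y ∈ C v then 1 else 0)
      = φ (fun j => 2 * z * (y j - q v j)) := by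
    intro y v
    by_cases hy : y ∈ C v
    · simp [hy]
    · simp [hout y v hy]
  have huniq : ∀ (y : Fin d → ℝ) v w, y ∈ C v → y ∈ C w → v = w := by
    intro y v w hv hw
    funext j
    obtain ⟨h1, h2⟩ := (hmem y v).1 hv j
    obtain ⟨h3, h4⟩ := (hmem y w).1 hw j
    have h5 : (v j : ℝ) < w j + 1 := by linarith
    have h6 : (w j : ℝ) < v j + 1 := by linarith
    norm_cast at h5 h6
    omega
  set N := Real.sqrt (∑ j, (x j - x' j) ^ 2)
  have hN : ‖x - x'‖ ≤ N := pi_norm_le_sqrt_sum_sq (x - x')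
  have hN0 : 0 ≤ N := Real.sqrt_nonneg _
  have hdiff : ∀ v, |φ (fun j => 2 * z * (x j - q v j)) - φ (fun j => 2 * z * (x' j - q v j))|
      ≤ 2 ^ β * z ^ β * N ^ β := by
    intro v
    rw [hφ', hφ']
    refine (abs_bump_sub_bump_le hβ0.le hβ1 _ _).trans ?_
    have hsub : (fun j => 2 * (z : ℝ) * (x j - q v j)) - (fun j => 2 * (z : ℝ) * (x' j - q v j))
        = (2 * (z : ℝ)) • (x - x') := by
      funext j
      simp only [Pi.sub_apply, Pi.smul_apply, smul_eq_mul]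
      ring
    rw [hsub, norm_smul, Real.norm_of_nonneg (by positivity), ← Real.mul_rpow two_pos.le hz0.le,
      ← Real.mul_rpow (by positivity) hN0]
    gcongr
  have hωabs : ∀ v, |ω v| ≤ 1 := by
    intro v
    rcases hω v with h | h | h <;> simp [h]
  rw [hf, hf, add_sub_add_left_eq_sub, mul_assoc 2]
  simp only [mul_assoc (Dφ * _), hterm]
  refine abs_sum_sub_sum_le_two_mul _ (fun v => x ∈ C v) (fun v => x' ∈ C v) _ _ (by positivity)
    (huniq x) (huniq x') (fun v hv => by simp [hout x v hv]) (fun v hv => by simp [hout x' v hv])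
    fun v => ?_
  rw [← mul_sub, ← mul_sub, abs_mul, abs_mul, abs_of_pos (by positivity : 0 < Dφ * (z : ℝ) ^ (-β))]
  calc |ω v| * (Dφ * (z : ℝ) ^ (-β) * |φ (fun j => 2 * z * (x j - q v j)) -
        φ (fun j => 2 * z * (x' j - q v j))|)
      ≤ 1 * (Dφ * (z : ℝ) ^ (-β) * (2 ^ β * z ^ β * N ^ β)) := by
        gcongr
        · exact hωabs v
        · exact hdiff v
    _ = Dφ * 2 ^ β * N ^ β := by
        rw [Real.rpow_neg hz0.le]
        field_simp
    _ ≤ L * N ^ β := by gcongr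
end

section
/- Fix an integer d ≥ 1, β ∈ (0,1], L > 0, α > 0 with αβ ≤ 1, and an integer z ≥ 1. Set D_φ = min(2^{−β}L, 1/4). For v ∈ {1,…,z}^d, let C_v = ∏_{j=1}^d [(v_j−1)/z, v_j/z) be the half-open cube of side length 1/z with center q_v whose j-th coordinate is (v_j − 1/2)/z. Let ω : {1,…,z}^d → {−1, 0, 1} be an assignment such that the number of v with ω(v) ≠ 0 is at most ⌈z^{d−αβ}⌉, and define f_ω : [0,1]^d → ℝ by f_ω(x) = 1/2 + Σ_v ω(v) · D_φ z^{−β} φ(2z(x − q_v)) · 1{x ∈ C_v}. Then for every δ > 0, the Lebesgue measure of the set {x ∈ [0,1]^d : 0 < |f_ω(x) − 1/2| ≤ D_φ δ} is at most 2(1+d)δ^α. -/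
/-- A sup-norm annulus of outer radius `r` and relative width `t` has volume at most
`(2r)^d (1+d) t^γ` for every exponent `γ ∈ [0,1]`. -/
theorem volume_annulus_le_rpow {d : ℕ} (c : Fin d → ℝ) {r t γ : ℝ} (hr : 0 < r) (ht : 0 < t)
    (hγ0 : 0 ≤ γ) (hγ1 : γ ≤ 1) :
    MeasureTheory.volume (Metric.closedBall c r \ Metric.ball c ((1 - t) * r))
      ≤ ENNReal.ofReal ((2 * r) ^ d * ((1 + d) * t ^ γ)) := by
  have hd : (0 : ℝ) ≤ d := d.cast_nonneg
  have hpow : 0 ≤ (2 * r) ^ d := by positivity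
  rcases le_or_gt 1 t with h1 | h1
  · refine (MeasureTheory.measure_mono Set.sdiff_subset).trans ?_
    rw [Real.volume_pi_closedBall c hr.le, Fintype.card_fin]
    refine ENNReal.ofReal_le_ofReal (le_mul_of_one_le_right hpow ?_)
    nlinarith [Real.one_le_rpow h1 hγ0]
  have hin : 0 < (1 - t) * r := mul_pos (by linarith) hr
  have hsub : Metric.ball c ((1 - t) * r) ⊆ Metric.closedBall c r :=
    Metric.ball_subset_closedBall.trans (Metric.closedBall_subset_closedBall (by nlinarith))
  rw [MeasureTheory.measure_sdiff hsub measurableSet_ball.nullMeasurableSet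
      MeasureTheory.measure_ball_lt_top.ne,
    Real.volume_pi_closedBall c hr.le, Real.volume_pi_ball c hin, Fintype.card_fin,
    ← ENNReal.ofReal_sub _ (by positivity)]
  refine ENNReal.ofReal_le_ofReal ?_
  have hbern : 1 - d * t ≤ (1 - t) ^ d := by
    have := one_add_mul_le_pow (a := -t) (by linarith) d
    simpa [← sub_eq_add_neg] using this
  have htγ : t ≤ t ^ γ := by
    simpa using Real.rpow_le_rpow_of_exponent_ge ht h1.le hγ1
  have hle : 1 - (1 - t) ^ d ≤ (1 + d) * t ^ γ := by nlinarith
  calc (2 * r) ^ d - (2 * ((1 - t) * r)) ^ d = (2 * r) ^ d * (1 - (1 - t) ^ d) := by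
        rw [show 2 * ((1 - t) * r) = 2 * r * (1 - t) by ring, mul_pow (2 * r)]; ring
    _ ≤ _ := mul_le_mul_of_nonneg_left hle hpow

open scoped Classical in
/-- The hard instances `f_ω` (with at most `⌈z^(d-αβ)⌉` active bumps),
paired with the constant arm `1/2`, satisfy the margin condition with parameter `α` under
the uniform covariate distribution: for every `δ > 0`, the Lebesgue measure of
`{x ∈ [0,1]^d : 0 < |f_ω(x) - 1/2| ≤ D_φ δ}` is at most `2(1+d) δ^α`. -/
theorem stmt_4 (d z : ℕ) (hd : 1 ≤ d) (hz : 1 ≤ z)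
    (β L α : ℝ) (hβ0 : 0 < β) (hβ1 : β ≤ 1) (hL : 0 < L) (hα : 0 < α) (hαβ : α * β ≤ 1)
    (φ : (Fin d → ℝ) → ℝ)
    (hφ : ∀ x : Fin d → ℝ, φ x = if ‖x‖ ≤ 1 then (1 - ‖x‖) ^ β else 0)
    (Dφ : ℝ) (hDφ : Dφ = min ((2 : ℝ) ^ (-β) * L) (1 / 4))
    (q : (Fin d → ℕ) → Fin d → ℝ)
    (hq : ∀ v j, q v j = ((v j : ℝ) - 1 / 2) / z)
    (C : (Fin d → ℕ) → Set (Fin d → ℝ))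
    (hC : ∀ v, C v = {x | ∀ j, ((v j : ℝ) - 1) / z ≤ x j ∧ x j < (v j : ℝ) / z})
    (ω : (Fin d → ℕ) → ℝ) (hω : ∀ v, ω v = -1 ∨ ω v = 0 ∨ ω v = 1)
    (hsupp : ((Fintype.piFinset (fun _ : Fin d => Finset.Icc 1 z)).filter
        (fun v => ω v ≠ 0)).card ≤ ⌈(z : ℝ) ^ ((d : ℝ) - α * β)⌉₊)
    (f : (Fin d → ℝ) → ℝ)
    (hf : ∀ x : Fin d → ℝ,
      f x = 1 / 2 + ∑ v ∈ Fintype.piFinset (fun _ : Fin d => Finset.Icc 1 z),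
        ω v * (Dφ * (z : ℝ) ^ (-β) * φ (fun j => 2 * z * (x j - q v j)) *
          (if x ∈ C v then 1 else 0)))
    (δ : ℝ) (hδ : 0 < δ) :
    MeasureTheory.volume
        {x : Fin d → ℝ | (∀ j, x j ∈ Set.Icc (0 : ℝ) 1) ∧
          0 < |f x - 1 / 2| ∧ |f x - 1 / 2| ≤ Dφ * δ}
      ≤ ENNReal.ofReal (2 * (1 + d) * δ ^ α) := by
  have hz0 : (0 : ℝ) < z := by exact_mod_cast hz
  have hD : 0 < Dφ := by rw [hDφ]; positivity
  set γ := α * β with hγ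
  have hγ0 : 0 < γ := mul_pos hα hβ0
  set t : ℝ := z * δ ^ β⁻¹ with ht
  have ht0 : 0 < t := by positivity
  set S := (Fintype.piFinset (fun _ : Fin d => Finset.Icc 1 z)).filter (fun v => ω v ≠ 0) with hS
  have hcell : ∀ v w x, x ∈ C v → x ∈ C w → v = w := by
    intro v w x hv hw
    rw [hC] at hv hw
    funext j
    obtain ⟨h1, h2⟩ := hv j
    obtain ⟨h3, h4⟩ := hw j
    have h5 := (div_lt_div_iff_of_pos_right hz0).1 (h1.trans_lt h4)
    have h6 := (div_lt_div_iff_of_pos_right hz0).1 (h3.trans_lt h2)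
    have h7 : v j < w j + 1 := by exact_mod_cast (by linarith : (v j : ℝ) < w j + 1)
    have h8 : w j < v j + 1 := by exact_mod_cast (by linarith : (w j : ℝ) < v j + 1)
    omega
  have hcover : {x : Fin d → ℝ | (∀ j, x j ∈ Set.Icc (0 : ℝ) 1) ∧
      0 < |f x - 1 / 2| ∧ |f x - 1 / 2| ≤ Dφ * δ} ⊆
      ⋃ v ∈ S, Metric.closedBall (q v) (1 / (2 * z)) \
        Metric.ball (q v) ((1 - t) * (1 / (2 * z))) := by
    rintro x ⟨-, hpos, hle⟩
    rw [hf, add_sub_cancel_left] at hpos hle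
    obtain ⟨v, hv, hne⟩ := Finset.exists_ne_zero_of_sum_ne_zero (abs_pos.1 hpos)
    have hωv : ω v ≠ 0 := left_ne_zero_of_mul hne
    have hxv : x ∈ C v := by
      by_contra h
      simp [h] at hne
    rw [Finset.sum_eq_single_of_mem v hv (fun w _ hw => by
      rw [if_neg fun h => hw (hcell w v x h hxv), mul_zero, mul_zero]), if_pos hxv, mul_one,
      abs_mul] at hle
    have habs : |ω v| = 1 := by
      rcases hω v with h | h | h
      · simp [h]
      · exact absurd h hωv
      · simp [h]
    have hscale : (fun j => 2 * z * (x j - q v j)) = (2 * z : ℝ) • (x - q v) := rfl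
    have hnorm : ‖(2 * z : ℝ) • (x - q v)‖ = 2 * z * dist x (q v) := by
      rw [norm_smul, Real.norm_of_nonneg (by positivity), dist_eq_norm]
    have hball : dist x (q v) ≤ 1 / (2 * z) := by
      refine (dist_pi_le_iff (by positivity)).2 fun j => ?_
      rw [hC] at hxv
      obtain ⟨h1, h2⟩ := hxv j
      have e1 : ((v j : ℝ) - 1) / z = q v j - 1 / (2 * z) := by rw [hq]; field_simp; ring
      have e2 : (v j : ℝ) / z = q v j + 1 / (2 * z) := by rw [hq]; field_simp; ring
      rw [Real.dist_eq, abs_le]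
      constructor <;> linarith
    have hy : 2 * z * dist x (q v) ≤ 1 := by
      rw [le_div_iff₀ (by positivity)] at hball
      linarith
    rw [habs, one_mul, hφ, hscale, hnorm, if_pos hy, abs_of_nonneg
      (mul_nonneg (by positivity) (Real.rpow_nonneg (by linarith) _)), mul_assoc,
      mul_le_mul_iff_right₀ hD, Real.rpow_neg hz0.le, inv_mul_le_iff₀ (by positivity)] at hle
    have hwidth : 1 - 2 * z * dist x (q v) ≤ t := by
      rw [← Real.rpow_le_rpow_iff (by linarith) ht0.le hβ0, ht,
        Real.mul_rpow hz0.le (by positivity), Real.rpow_inv_rpow hδ.le hβ0.ne']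
      exact hle
    refine Set.mem_biUnion (Finset.mem_filter.2 ⟨hv, hωv⟩) ⟨hball, ?_⟩
    rw [Metric.mem_ball, not_lt, mul_one_div, div_le_iff₀ (by positivity)]
    linarith
  have hcard : (S.card : ℝ) ≤ 2 * (z : ℝ) ^ ((d : ℝ) - γ) := by
    have hd' : (1 : ℝ) ≤ d := by exact_mod_cast hd
    have hone : 1 ≤ (z : ℝ) ^ ((d : ℝ) - γ) :=
      Real.one_le_rpow (by exact_mod_cast hz) (by linarith)
    have hlt := Nat.ceil_lt_add_one (zero_le_one.trans hone)
    have hS' : (S.card : ℝ) ≤ ⌈(z : ℝ) ^ ((d : ℝ) - γ)⌉₊ := by exact_mod_cast hsupp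
    linarith
  have htγ : t ^ γ = (z : ℝ) ^ γ * δ ^ α := by
    rw [ht, Real.mul_rpow hz0.le (by positivity), ← Real.rpow_mul hδ.le, hγ]
    congr 2
    field_simp
  calc _ ≤ ∑ v ∈ S, ENNReal.ofReal ((2 * (1 / (2 * z))) ^ d * ((1 + d) * t ^ γ)) :=
        (MeasureTheory.measure_mono hcover).trans <|
          (MeasureTheory.measure_biUnion_finset_le _ _).trans <| Finset.sum_le_sum fun v _ =>
            volume_annulus_le_rpow (q v) (by positivity) ht0 hγ0.le hαβ
    _ = ENNReal.ofReal (S.card * ((2 * (1 / (2 * z))) ^ d * ((1 + d) * t ^ γ))) := by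
        rw [Finset.sum_const, nsmul_eq_mul, ENNReal.ofReal_mul S.card.cast_nonneg,
          ENNReal.ofReal_natCast]
    _ ≤ ENNReal.ofReal (2 * (z : ℝ) ^ ((d : ℝ) - γ) *
          ((2 * (1 / (2 * z))) ^ d * ((1 + d) * t ^ γ))) := by gcongr
    _ = _ := by
        rw [htγ, Real.rpow_sub hz0, Real.rpow_natCast,
          show (2 * (1 / (2 * z)) : ℝ) = (z : ℝ)⁻¹ by field_simp, inv_pow]
        have : (z : ℝ) ^ γ ≠ 0 := by positivity
        congr 1
        field_simp
end

section
/- Fix integers d ≥ 1, M ≥ 1, z ≥ 1, β ∈ (0,1], and α > 0 with αβ ≤ 1, and suppose M^{−αβ} z^{d−αβ} ≥ 1. Set s = ⌈M^{−αβ} z^{d−αβ}⌉. Let C_1, …, C_s be s distinct cubes from the regular partition of [0,1]^d into (Mz)^d cubes of side length 1/(Mz), with centers q_1, …, q_s. Then for every δ ∈ [0,1], Σ_{j=1}^s Leb{ x ∈ C_j : 0 < φ(2Mz(x − q_j)) ≤ δ(Mz)^β } ≤ 2(1+d) M^{−d} δ^α, where Leb denotes Lebesgue measure. -/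
open MeasureTheory Metric in
theorem volume_ball_sdiff_ball_le {ι : Type*} [Fintype ι] [Nonempty ι] (q : ι → ℝ)
    {r t γ : ℝ} (hr : 0 < r) (ht : 0 ≤ t) (hγ0 : 0 ≤ γ) (hγ1 : γ ≤ 1) :
    volume (ball q r \ ball q (r * (1 - t))) ≤
      ENNReal.ofReal ((2 * r) ^ Fintype.card ι * (Fintype.card ι * t ^ γ)) := by
  have hcard : (1 : ℝ) ≤ Fintype.card ι := by exact_mod_cast Fintype.card_pos
  rcases lt_or_ge t 1 with h | h
  · have hr' : 0 < r * (1 - t) := mul_pos hr (by linarith)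
    have hsub : ball q (r * (1 - t)) ⊆ ball q r := ball_subset_ball (by nlinarith)
    rw [measure_sdiff hsub measurableSet_ball.nullMeasurableSet measure_ball_lt_top.ne,
      Real.volume_pi_ball _ hr, Real.volume_pi_ball _ hr',
      ← ENNReal.ofReal_sub _ (by positivity)]
    refine ENNReal.ofReal_le_ofReal ?_
    have hbern : 1 + (Fintype.card ι : ℝ) * (-t) ≤ (1 + -t) ^ Fintype.card ι :=
      one_add_mul_le_pow (by linarith) _
    have hpow : t ≤ t ^ γ := by
      simpa using Real.rpow_le_rpow_of_exponent_ge' ht h.le hγ0 hγ1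
    calc (2 * r) ^ Fintype.card ι - (2 * (r * (1 - t))) ^ Fintype.card ι
        = (2 * r) ^ Fintype.card ι * (1 - (1 + -t) ^ Fintype.card ι) := by
          rw [← mul_assoc, mul_pow _ (1 - t)]; ring
      _ ≤ (2 * r) ^ Fintype.card ι * (Fintype.card ι * t) := by gcongr; linarith
      _ ≤ _ := by gcongr
  · refine (measure_mono Set.sdiff_subset).trans ?_
    rw [Real.volume_pi_ball _ hr]
    refine ENNReal.ofReal_le_ofReal (le_mul_of_one_le_right (by positivity) ?_)
    exact one_le_mul_of_one_le_of_one_le hcard (Real.one_le_rpow h hγ0)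

open Metric in
theorem mem_ball_sdiff_ball_of_bump {ι : Type*} [Fintype ι] {φ : (ι → ℝ) → ℝ} {β : ℝ}
    (hβ : 0 < β) (hφ : ∀ x, φ x = if ‖x‖ ≤ 1 then (1 - ‖x‖) ^ β else 0)
    {c t : ℝ} (hc : 0 < c) (ht : 0 ≤ t) {x q : ι → ℝ}
    (hpos : 0 < φ (c • (x - q))) (hle : φ (c • (x - q)) ≤ t ^ β) :
    x ∈ ball q c⁻¹ \ ball q (c⁻¹ * (1 - t)) := by
  have hnorm : ‖c • (x - q)‖ = c * dist x q := by
    rw [norm_smul, Real.norm_of_nonneg hc.le, dist_eq_norm]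
  rw [hφ, hnorm] at hpos hle
  split_ifs at hpos hle with h
  · have hne : c * dist x q ≠ 1 := fun h1 => by
      rw [h1, sub_self, Real.zero_rpow hβ.ne'] at hpos
      exact hpos.false
    have h1t := (Real.rpow_le_rpow_iff (by linarith) ht hβ).1 hle
    refine ⟨?_, fun hx => ?_⟩
    · rw [mem_ball, ← one_div, lt_div_iff₀' hc]
      exact lt_of_le_of_ne h hne
    · rw [mem_ball, ← div_eq_inv_mul, lt_div_iff₀' hc] at hx
      linarith
  · exact absurd hpos (lt_irrefl _)


/-- Lemma `margin-check` of the paper, with a safe factor 2.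
For `s = ⌈M^(-αβ) z^(d-αβ)⌉` distinct cubes `C 1, …, C s` of the regular partition of
`[0,1]^d` into `(Mz)^d` cubes of side `1/(Mz)` with centers `q j`, and every `δ ∈ [0,1]`,
`∑_j Leb {x ∈ C j : 0 < φ(2Mz(x - q j)) ≤ δ (Mz)^β} ≤ 2(1+d) M^(-d) δ^α`. -/
theorem stmt_5 (d M z : ℕ) (hd : 1 ≤ d) (hM : 1 ≤ M) (hz : 1 ≤ z)
    (β α : ℝ) (hβ0 : 0 < β) (hβ1 : β ≤ 1) (hα : 0 < α) (hαβ : α * β ≤ 1)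
    (hbig : 1 ≤ (M : ℝ) ^ (-(α * β)) * (z : ℝ) ^ ((d : ℝ) - α * β))
    (s : ℕ) (hs : s = ⌈(M : ℝ) ^ (-(α * β)) * (z : ℝ) ^ ((d : ℝ) - α * β)⌉₊)
    (φ : (Fin d → ℝ) → ℝ)
    (hφ : ∀ x : Fin d → ℝ, φ x = if ‖x‖ ≤ 1 then (1 - ‖x‖) ^ β else 0)
    (v : Fin s → Fin d → ℕ) (hv_inj : Function.Injective v)
    (hv_range : ∀ j i, 1 ≤ v j i ∧ v j i ≤ M * z)
    (C : Fin s → Set (Fin d → ℝ))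
    (hC : ∀ j, C j = {x | ∀ i, ((v j i : ℝ) - 1) / (M * z) ≤ x i ∧
        x i < (v j i : ℝ) / (M * z)})
    (q : Fin s → Fin d → ℝ)
    (hq : ∀ j i, q j i = ((v j i : ℝ) - 1 / 2) / (M * z))
    (δ : ℝ) (hδ0 : 0 ≤ δ) (hδ1 : δ ≤ 1) :
    (∑ j : Fin s, MeasureTheory.volume
        {x : Fin d → ℝ | x ∈ C j ∧
          0 < φ (fun i => 2 * M * z * (x i - q j i)) ∧
          φ (fun i => 2 * M * z * (x i - q j i)) ≤ δ * ((M : ℝ) * z) ^ β})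
      ≤ ENNReal.ofReal (2 * (1 + d) * (M : ℝ) ^ (-(d : ℝ)) * δ ^ α) := by
  have : Nonempty (Fin d) := ⟨⟨0, hd⟩⟩
  have hM0 : (0 : ℝ) < M := by exact_mod_cast hM
  have hz0 : (0 : ℝ) < z := by exact_mod_cast hz
  have hαβ0 : 0 ≤ α * β := (mul_pos hα hβ0).le
  set t : ℝ := δ ^ β⁻¹ * (M * z) with ht_def
  have ht : 0 ≤ t := by positivity
  have htβ : t ^ β = δ * ((M : ℝ) * z) ^ β := by
    rw [ht_def, Real.mul_rpow (by positivity) (by positivity), ← Real.rpow_mul hδ0,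
      inv_mul_cancel₀ hβ0.ne', Real.rpow_one]
  have htαβ : t ^ (α * β) = δ ^ α * ((M : ℝ) ^ (α * β) * (z : ℝ) ^ (α * β)) := by
    rw [mul_comm α β, Real.rpow_mul ht, htβ, Real.mul_rpow hδ0 (by positivity),
      ← Real.rpow_mul (by positivity), Real.mul_rpow hM0.le hz0.le]
  have hblock : ∀ j : Fin s, MeasureTheory.volume
      {x : Fin d → ℝ | x ∈ C j ∧
        0 < φ (fun i => 2 * M * z * (x i - q j i)) ∧
        φ (fun i => 2 * M * z * (x i - q j i)) ≤ δ * ((M : ℝ) * z) ^ β} ≤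
      ENNReal.ofReal ((2 * (2 * M * z : ℝ)⁻¹) ^ d * (d * t ^ (α * β))) := fun j => by
    have hvol := volume_ball_sdiff_ball_le (q j) (r := (2 * M * z : ℝ)⁻¹) (by positivity)
      ht hαβ0 hαβ
    rw [Fintype.card_fin] at hvol
    refine (MeasureTheory.measure_mono ?_).trans hvol
    rintro x ⟨-, hpos, hle⟩
    rw [← htβ] at hle
    exact mem_ball_sdiff_ball_of_bump hβ0 hφ (by positivity) ht hpos hle
  refine (Finset.sum_le_sum fun j _ => hblock j).trans ?_
  rw [Finset.sum_const, Finset.card_univ, Fintype.card_fin, nsmul_eq_mul,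
    ← ENNReal.ofReal_natCast, ← ENNReal.ofReal_mul (by positivity)]
  refine ENNReal.ofReal_le_ofReal ?_
  have hs2 : (s : ℝ) ≤ 2 * ((M : ℝ) ^ (-(α * β)) * (z : ℝ) ^ ((d : ℝ) - α * β)) := by
    have := Nat.ceil_lt_add_one (zero_le_one.trans hbig)
    rw [← hs] at this
    linarith
  calc (s : ℝ) * ((2 * (2 * M * z : ℝ)⁻¹) ^ d * (d * t ^ (α * β)))
      ≤ 2 * ((M : ℝ) ^ (-(α * β)) * (z : ℝ) ^ ((d : ℝ) - α * β)) *
          ((2 * (2 * M * z : ℝ)⁻¹) ^ d * (d * t ^ (α * β))) := by gcongr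
    _ = 2 * d * (M : ℝ) ^ (-(d : ℝ)) * δ ^ α := by
      have hside : 2 * (2 * M * z : ℝ)⁻¹ = (M : ℝ)⁻¹ * (z : ℝ)⁻¹ := by field_simp
      rw [htαβ, hside, mul_pow, Real.rpow_neg hM0.le, Real.rpow_neg hM0.le,
        Real.rpow_sub hz0, Real.rpow_natCast, Real.rpow_natCast, inv_pow, inv_pow]
      field_simp
    _ ≤ 2 * (1 + d) * (M : ℝ) ^ (-(d : ℝ)) * δ ^ α := by
      gcongr
      linarith
end

section
/- Let (Ω, μ) be a probability space, let α > 0, D₀ > 0, δ₀ ∈ (0,1), and let g : Ω → [0,1] be measurable with μ({ω : 0 < g(ω) ≤ δ}) ≤ D₀ δ^α for every δ ∈ (0, δ₀]. Then for every real n ≥ 1 and every measurable h : Ω → [0, n], ∫ h · 1{g > 0} dμ ≤ (D₀ + 1 + δ₀^{−1}) · n^{1/(1+α)} · (∫ h·g dμ)^{α/(1+α)}. -/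
open MeasureTheory in
/-- Splitting `{g > 0}` at the level `δ` bounds the mass of `h` there by the mass of the thin layer
`{0 < g ≤ δ}` and a Markov-type term. -/
theorem setIntegral_pos_le_layer_add_div {Ω : Type*} [MeasurableSpace Ω] {μ : Measure Ω}
    [IsFiniteMeasure μ] {g h : Ω → ℝ} {n δ : ℝ} (hg_meas : Measurable g) (hg : ∀ ω, 0 ≤ g ω)
    (hh : ∀ ω, h ω ∈ Set.Icc (0 : ℝ) n) (hh_int : Integrable h μ)
    (hhg_int : Integrable (fun ω ↦ h ω * g ω) μ) (hδ : 0 < δ) :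
    ∫ ω in {ω | 0 < g ω}, h ω ∂μ ≤
      n * μ.real {ω | 0 < g ω ∧ g ω ≤ δ} + (∫ ω, h ω * g ω ∂μ) / δ := by
  have hpos : MeasurableSet {ω | 0 < g ω} := measurableSet_lt measurable_const hg_meas
  have hlayer : MeasurableSet {ω | 0 < g ω ∧ g ω ≤ δ} :=
    hpos.inter (measurableSet_le hg_meas measurable_const)
  have hlayer_int : Integrable ({ω | 0 < g ω ∧ g ω ≤ δ}.indicator fun _ ↦ n) μ :=
    (integrable_const n).indicator hlayer
  calc ∫ ω in {ω | 0 < g ω}, h ω ∂μ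
      = ∫ ω, {ω | 0 < g ω}.indicator h ω ∂μ := (integral_indicator hpos).symm
    _ ≤ ∫ ω, ({ω | 0 < g ω ∧ g ω ≤ δ}.indicator (fun _ ↦ n) ω + h ω * g ω / δ) ∂μ := by
        refine integral_mono (hh_int.indicator hpos) (hlayer_int.add (hhg_int.div_const δ)) ?_
        intro ω
        obtain ⟨h0, hn⟩ := hh ω
        have hdiv : 0 ≤ h ω * g ω / δ := div_nonneg (mul_nonneg h0 (hg ω)) hδ.le
        by_cases hgω : 0 < g ω
        · by_cases hgδ : g ω ≤ δ
          · simp only [Set.indicator, Set.mem_ofPred_eq, hgω, hgδ, and_self, if_true]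
            linarith
          · simp only [Set.indicator, Set.mem_ofPred_eq, hgω, hgδ, and_false, if_true, if_false,
              zero_add]
            rw [le_div_iff₀ hδ]
            exact mul_le_mul_of_nonneg_left (not_le.mp hgδ).le h0
        · simp only [Set.indicator, Set.mem_ofPred_eq, hgω, false_and, if_false, zero_add]
          exact hdiv
    _ = n * μ.real {ω | 0 < g ω ∧ g ω ≤ δ} + (∫ ω, h ω * g ω ∂μ) / δ := by
        rw [integral_add hlayer_int (hhg_int.div_const δ), integral_indicator_const n hlayer,
          integral_div, smul_eq_mul, mul_comm]


open MeasureTheory in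
/-- measure-theoretic content of Lemma `inferior-to-regret`.
On a probability space, if `g : Ω → [0,1]` satisfies the margin condition
`μ {0 < g ≤ δ} ≤ D₀ δ^α` for `δ ∈ (0, δ₀]`, then for every `n ≥ 1` and measurable
`h : Ω → [0,n]`, `∫ h·1{g>0} dμ ≤ (D₀ + 1 + δ₀⁻¹) n^(1/(1+α)) (∫ h g dμ)^(α/(1+α))`. -/
theorem stmt_7 {Ω : Type*} [MeasurableSpace Ω] (μ : Measure Ω) [IsProbabilityMeasure μ]
    (α D₀ δ₀ : ℝ) (hα : 0 < α) (hD₀ : 0 < D₀) (hδ₀0 : 0 < δ₀) (hδ₀1 : δ₀ < 1)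
    (g : Ω → ℝ) (hg_meas : Measurable g) (hg_range : ∀ ω, g ω ∈ Set.Icc (0 : ℝ) 1)
    (hmargin : ∀ δ : ℝ, 0 < δ → δ ≤ δ₀ →
      μ {ω | 0 < g ω ∧ g ω ≤ δ} ≤ ENNReal.ofReal (D₀ * δ ^ α))
    (n : ℝ) (hn : 1 ≤ n)
    (h : Ω → ℝ) (hh_meas : Measurable h) (hh_range : ∀ ω, h ω ∈ Set.Icc (0 : ℝ) n) :
    ∫ ω in {ω | 0 < g ω}, h ω ∂μ ≤
      (D₀ + 1 + δ₀⁻¹) * n ^ (1 / (1 + α)) * (∫ ω, h ω * g ω ∂μ) ^ (α / (1 + α)) := by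
  have hn0 : 0 < n := by linarith
  have hα1 : 0 < 1 + α := by linarith
  have hh_int : Integrable h μ :=
    .of_bound hh_meas.aestronglyMeasurable n <| .of_forall fun ω ↦ by
      rw [Real.norm_of_nonneg (hh_range ω).1]
      exact (hh_range ω).2
  have hhg_le (ω : Ω) : h ω * g ω ≤ n :=
    (mul_le_of_le_one_right (hh_range ω).1 (hg_range ω).2).trans (hh_range ω).2
  have hhg_nonneg (ω : Ω) : 0 ≤ h ω * g ω := mul_nonneg (hh_range ω).1 (hg_range ω).1
  have hhg_int : Integrable (fun ω ↦ h ω * g ω) μ :=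
    .of_bound (hh_meas.mul hg_meas).aestronglyMeasurable n <| .of_forall fun ω ↦ by
      rw [Real.norm_of_nonneg (hhg_nonneg ω)]
      exact hhg_le ω
  have hsplit {δ : ℝ} (hδ : 0 < δ) :=
    setIntegral_pos_le_layer_add_div hg_meas (fun ω ↦ (hg_range ω).1) hh_range hh_int hhg_int hδ
  have hR0 : 0 ≤ ∫ ω, h ω * g ω ∂μ := integral_nonneg hhg_nonneg
  have hRn : ∫ ω, h ω * g ω ∂μ ≤ n := by
    simpa using integral_mono hhg_int (integrable_const n) hhg_le
  rcases hR0.eq_or_lt with hR | hR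
  · rw [← hR, Real.zero_rpow (div_pos hα hα1).ne', mul_zero]
    refine (setIntegral_congr_ae (g := fun _ ↦ (0 : ℝ))
      (measurableSet_lt measurable_const hg_meas) ?_).le.trans_eq (by simp)
    filter_upwards [(integral_eq_zero_iff_of_nonneg hhg_nonneg hhg_int).mp hR.symm] with ω hω hgω
    exact (mul_eq_zero.mp hω).resolve_right (ne_of_gt hgω)
  · generalize (∫ ω, h ω * g ω ∂μ) = R at *
    -- The level `δ₀ ε` balances the two terms, since `R = n ε ^ (1 + α)`.
    obtain ⟨ε, hε⟩ : ∃ ε, ε = (R / n) ^ (1 / (1 + α)) := ⟨_, rfl⟩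
    have hε0 : 0 < ε := hε ▸ Real.rpow_pos_of_pos (div_pos hR hn0) _
    have hε1 : ε ≤ 1 :=
      hε ▸ Real.rpow_le_one (div_pos hR hn0).le ((div_le_one hn0).mpr hRn) (by positivity)
    have hεR : R = n * (ε ^ α * ε) := by
      rw [← Real.rpow_add_one hε0.ne', hε, ← Real.rpow_mul (div_pos hR hn0).le, add_comm α,
        one_div_mul_cancel hα1.ne', Real.rpow_one, mul_div_cancel₀ _ hn0.ne']
    have hεn : n ^ (1 / (1 + α)) * R ^ (α / (1 + α)) = n * ε ^ α := by
      have hexp : 1 / (1 + α) = 1 - α / (1 + α) := by field_simp; ring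
      rw [hε, ← Real.rpow_mul (div_pos hR hn0).le, one_div_mul_eq_div,
        Real.div_rpow hR.le hn0.le, hexp, Real.rpow_sub hn0, Real.rpow_one]
      ring
    have hδ : 0 < δ₀ * ε := mul_pos hδ₀0 hε0
    have hlayer : μ.real {ω | 0 < g ω ∧ g ω ≤ δ₀ * ε} ≤ D₀ * ε ^ α :=
      calc μ.real {ω | 0 < g ω ∧ g ω ≤ δ₀ * ε}
          ≤ D₀ * (δ₀ * ε) ^ α := ENNReal.toReal_le_of_le_ofReal (by positivity)
            (hmargin _ hδ (mul_le_of_le_one_right hδ₀0.le hε1))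
        _ ≤ D₀ * ε ^ α := by
            gcongr
            exact mul_le_of_le_one_left hε0.le hδ₀1.le
    have hdiv : R / (δ₀ * ε) = δ₀⁻¹ * (n * ε ^ α) := by
      rw [hεR]
      field_simp
    have hnε : 0 < n * ε ^ α := mul_pos hn0 (Real.rpow_pos_of_pos hε0 α)
    calc ∫ ω in {ω | 0 < g ω}, h ω ∂μ
        ≤ n * μ.real {ω | 0 < g ω ∧ g ω ≤ δ₀ * ε} + R / (δ₀ * ε) := hsplit hδ
      _ ≤ n * (D₀ * ε ^ α) + δ₀⁻¹ * (n * ε ^ α) := by rw [hdiv]; gcongr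
      _ ≤ (D₀ + 1 + δ₀⁻¹) * (n * ε ^ α) := by linarith
      _ = (D₀ + 1 + δ₀⁻¹) * n ^ (1 / (1 + α)) * R ^ (α / (1 + α)) := by rw [← hεn, mul_assoc]
end

section
/- Let P and Q be probability measures on a common measurable space and let A be a measurable set. Then P(A) + Q(Aᶜ) ≥ (1/2)·exp(−KL(P‖Q)), where KL(P‖Q) denotes the Kullback–Leibler divergence of P from Q (with the convention exp(−∞) = 0 when KL(P‖Q) = ∞). -/
open MeasureTheory
open scoped Classical

/-- The Kullback–Leibler divergence `KL(P‖Q)`, valued in `EReal`: it is the integral of the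
log-likelihood ratio `llr P Q = log (dP/dQ)` against `P` when `P ≪ Q` and this integral
exists, and `⊤` otherwise. -/
noncomputable def klDiv {Ω : Type*} [MeasurableSpace Ω] (P Q : Measure Ω) : EReal :=
  if P ≪ Q ∧ Integrable (llr P Q) P then ((∫ x, llr P Q x ∂P : ℝ) : EReal) else ⊤

/-- The pointwise bound behind the Bretagnolle–Huber inequality: the minimum of `1` and the
inverse likelihood ratio `exp (-l)` dominates an affine function of `l` and `exp (-l)`. -/
lemma exp_neg_mul_affine_le {a l m : ℝ} (ha : a = 1 ∨ a = Real.exp (-l)) :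
    Real.exp (-m) * (1 - (l - m) / 2) ≤ a + Real.exp (-m) / 4 * (1 + Real.exp (-l)) := by
  have hl : Real.exp (-l) = Real.exp (-l / 2) ^ 2 := by
    rw [← Real.exp_nat_mul]; congr 1; push_cast; ring
  have hm : Real.exp (-m) = Real.exp (-m / 2) ^ 2 := by
    rw [← Real.exp_nat_mul]; congr 1; push_cast; ring
  have tangent : Real.exp (-m / 2) * (1 - (l - m) / 2) ≤ Real.exp (-l / 2) := by
    have h := Real.add_one_le_exp (-(l - m) / 2)
    have hsplit : Real.exp (-l / 2) = Real.exp (-m / 2) * Real.exp (-(l - m) / 2) := by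
      rw [← Real.exp_add]; congr 1; ring
    rw [hsplit]
    gcongr
    linarith
  have hv := Real.exp_pos (-m / 2)
  rw [hl] at ha
  rw [hl, hm]
  set u := Real.exp (-l / 2)
  set v := Real.exp (-m / 2)
  have key : v ^ 2 * (1 - (l - m) / 2) ≤ v * u := by
    rw [sq, mul_assoc]
    gcongr
  rcases ha with rfl | rfl
  · nlinarith [sq_nonneg (1 - v * u / 2), sq_nonneg v]
  · nlinarith [sq_nonneg (u - v / 2), mul_nonneg (sq_nonneg v) (sq_nonneg u)]

/-- The Bretagnolle–Huber inequality in terms of the integral of the log-likelihood ratio. -/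
lemma half_exp_neg_integral_llr_le {Ω : Type*} [MeasurableSpace Ω] (P Q : Measure Ω)
    [IsProbabilityMeasure P] [IsProbabilityMeasure Q] (hPQ : P ≪ Q)
    (hint : Integrable (llr P Q) P) {A : Set Ω} (hA : MeasurableSet A) :
    1 / 2 * Real.exp (-∫ x, llr P Q x ∂P) ≤ P.real A + Q.real Aᶜ := by
  set m := ∫ x, llr P Q x ∂P with hm
  set g : Ω → ℝ := fun x ↦ (Q.rnDeriv P x).toReal
  have hg : Integrable g P := Measure.integrable_toReal_rnDeriv
  have hg_le : ∫ x, g x ∂P ≤ 1 := by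
    simpa using Measure.setIntegral_toReal_rnDeriv_le (μ := Q) (ν := P) (s := Set.univ)
      (measure_ne_top _ _)
  have hg_compl : ∫ x in Aᶜ, g x ∂P ≤ Q.real Aᶜ :=
    Measure.setIntegral_toReal_rnDeriv_le (measure_ne_top _ _)
  have h1 : Integrable (A.indicator (fun _ ↦ (1 : ℝ))) P :=
    (integrable_const 1).indicator hA
  have h2 : Integrable (Aᶜ.indicator g) P := hg.indicator hA.compl
  have h12 : Integrable (fun x ↦ A.indicator (fun _ ↦ (1 : ℝ)) x + Aᶜ.indicator g x) P :=
    h1.add h2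
  have hllr : Integrable (fun x ↦ (llr P Q x - m) / 2) P :=
    (hint.sub (integrable_const m)).div_const 2
  have h3 : Integrable (fun x ↦ Real.exp (-m) / 4 * (1 + g x)) P :=
    ((integrable_const 1).add hg).const_mul _
  have hmono : ∫ x, Real.exp (-m) * (1 - (llr P Q x - m) / 2) ∂P
      ≤ ∫ x, (A.indicator (fun _ ↦ (1 : ℝ)) x + Aᶜ.indicator g x)
        + Real.exp (-m) / 4 * (1 + g x) ∂P := by
    refine integral_mono_ae ?_ (h12.add h3) ?_
    · exact ((integrable_const 1).sub hllr).const_mul _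
    · filter_upwards [exp_neg_llr hPQ] with x hx
      have hgx : g x = Real.exp (-llr P Q x) := hx.symm
      rw [hgx]
      apply exp_neg_mul_affine_le
      by_cases hxA : x ∈ A <;> simp [hxA, hgx]
  have hleft : ∫ x, Real.exp (-m) * (1 - (llr P Q x - m) / 2) ∂P = Real.exp (-m) := by
    rw [integral_const_mul, integral_sub (integrable_const 1) hllr, integral_div,
      integral_sub hint (integrable_const m), ← hm]
    simp
  have hright : ∫ x, (A.indicator (fun _ ↦ (1 : ℝ)) x + Aᶜ.indicator g x)
        + Real.exp (-m) / 4 * (1 + g x) ∂P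
      = P.real A + ∫ x in Aᶜ, g x ∂P + Real.exp (-m) / 4 * (1 + ∫ x, g x ∂P) := by
    rw [integral_add h12 h3, integral_add h1 h2, integral_const_mul,
      integral_add (integrable_const 1) hg, integral_indicator hA, integral_indicator hA.compl]
    simp
  rw [hleft, hright] at hmono
  nlinarith [Real.exp_pos (-m)]

/-- Le Cam / Bretagnolle–Huber inequality. For probability measures `P, Q`
and a measurable set `A`, `P(A) + Q(Aᶜ) ≥ (1/2)·exp(−KL(P‖Q))`, with the convention that
the right-hand side is `0` when `KL(P‖Q) = ∞`. -/
theorem stmt_8 {Ω : Type*} [MeasurableSpace Ω] (P Q : Measure Ω)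
    [IsProbabilityMeasure P] [IsProbabilityMeasure Q]
    (A : Set Ω) (hA : MeasurableSet A) :
    (if klDiv P Q = ⊤ then 0
      else ENNReal.ofReal ((1 / 2) * Real.exp (-(klDiv P Q).toReal)))
      ≤ P A + Q Aᶜ := by
  split_ifs with htop
  · exact zero_le
  · have hfin : P ≪ Q ∧ Integrable (llr P Q) P := by
      by_contra h
      exact htop (if_neg h)
    have hkl : (klDiv P Q).toReal = ∫ x, llr P Q x ∂P := by
      rw [klDiv, if_pos hfin, EReal.toReal_coe]
    rw [hkl]
    refine (ENNReal.ofReal_le_ofReal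
      (half_exp_neg_integral_llr_le P Q hfin.1 hfin.2 hA)).trans_eq ?_
    rw [ENNReal.ofReal_add measureReal_nonneg measureReal_nonneg, ofReal_measureReal,
      ofReal_measureReal]
end
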